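/- Let π be a permutation of {1,…,n} that avoids the pattern 1432. Then every reduced pipe dream for π is pseudo-Yamanouchi. -/

import Mathlib

/-- `C` is a pipe dream of size `n`: a set of cross positions `(i,j)` in the
staircase `{(i,j) : i ≥ 1, j ≥ 1, i + j ≤ n}`. -/
def IsPipeDream (n : ℕ) (C : Finset (ℕ × ℕ)) : Prop :=
  ∀ p ∈ C, 1 ≤ p.1 ∧ 1 ≤ p.2 ∧ p.1 + p.2 ≤ n

/-- The reading word of a pipe dream: scan rows `i = n-1, …, 1` from bottom to top,
within each row scan columns `j` in increasing order, and record `i + j - 1`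
for each cross `(i,j) ∈ C`.  (Here row `r+1` for `r = n-2, …, 0` and column `c+1`,
recording `(r+1) + (c+1) - 1 = r + c + 1`.) -/
def readingWord (n : ℕ) (C : Finset (ℕ × ℕ)) : List ℕ :=
  (List.range (n - 1)).reverse.flatMap fun r =>
    (List.range n).filterMap fun c =>
      if (r + 1, c + 1) ∈ C then some (r + c + 1) else none

/-- `C` is pseudo-Yamanouchi: for every prefix of the reading word and every
`1 ≤ j ≤ n - 2`, the number of occurrences of `j+1` is at most `1` plus the
number of occurrences of `j`. -/
def PseudoYamanouchi (n : ℕ) (C : Finset (ℕ × ℕ)) : Prop :=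
  ∀ k j : ℕ, 1 ≤ j → j ≤ n - 2 →
    ((readingWord n C).take k).count (j + 1) ≤ 1 + ((readingWord n C).take k).count j

/-- `C` satisfies the TSSCPP inequalities: with `y` the 0-1 indicator of `C`,
for all `1 ≤ i < j ≤ n-1`, `1 + Σ_{k=1}^{i} y_{j-k,k} ≥ Σ_{k=1}^{i+1} y_{j-k+1,k}`. -/
def SatisfiesTSSCPP (n : ℕ) (C : Finset (ℕ × ℕ)) : Prop :=
  ∀ i j : ℕ, 1 ≤ i → i < j → j ≤ n - 1 →
    (∑ k ∈ Finset.Icc 1 (i + 1), if (j - k + 1, k) ∈ C then (1 : ℕ) else 0) ≤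
      1 + ∑ k ∈ Finset.Icc 1 i, if (j - k, k) ∈ C then (1 : ℕ) else 0

/-- `π` (a permutation of `{1,…,n}`) avoids the pattern 1432: there are no
`a < b < c < d` in `{1,…,n}` with `π a < π d < π c < π b`. -/
def Avoids1432 (n : ℕ) (π : Equiv.Perm ℕ) : Prop :=
  ¬ ∃ a b c d : ℕ, 1 ≤ a ∧ a < b ∧ b < c ∧ c < d ∧ d ≤ n ∧
      π a < π d ∧ π d < π c ∧ π c < π b

/-- `C` is a reduced pipe dream for `π`: the product of the adjacent
transpositions `s_{a_1} ⋯ s_{a_ℓ}` along the reading word of `C` equals `π`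
(where `s_a` swaps `a` and `a+1`), and the length `ℓ` of the reading word equals
the number of inversions of `π`. -/
def IsReducedPipeDream (n : ℕ) (π : Equiv.Perm ℕ) (C : Finset (ℕ × ℕ)) : Prop :=
  IsPipeDream n C ∧
  ((readingWord n C).map fun a => Equiv.swap a (a + 1)).prod = π ∧
  (readingWord n C).length =
    ((Finset.Icc 1 n ×ˢ Finset.Icc 1 n).filter fun p => p.1 < p.2 ∧ π p.2 < π p.1).card

/-- The product of the adjacent transpositions along a word. -/
def wordPerm (l : List ℕ) : Equiv.Perm ℕ := (l.map fun a => Equiv.swap a (a + 1)).prod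

theorem wordPerm_nil : wordPerm [] = 1 := rfl

theorem wordPerm_cons (a : ℕ) (l : List ℕ) :
    wordPerm (a :: l) = Equiv.swap a (a + 1) * wordPerm l := by
  simp [wordPerm]

theorem wordPerm_append (l m : List ℕ) : wordPerm (l ++ m) = wordPerm l * wordPerm m := by
  simp [wordPerm]

theorem wordPerm_apply_of_forall_ne {h : ℕ} {l : List ℕ} (hl : ∀ a ∈ l, a ≠ h ∧ a + 1 ≠ h) :
    wordPerm l h = h := by
  induction l with
  | nil => rfl
  | cons a l ih =>
    rw [wordPerm_cons, Equiv.Perm.mul_apply, ih fun b hb => hl b (by simp [hb])]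
    have := hl a (by simp)
    exact Equiv.swap_apply_of_ne_of_ne this.1.symm this.2.symm

theorem wordPerm_inv_apply_of_forall_ne {h : ℕ} {l : List ℕ}
    (hl : ∀ a ∈ l, a ≠ h ∧ a + 1 ≠ h) : (wordPerm l)⁻¹ h = h := by
  rw [Equiv.Perm.inv_eq_iff_eq, wordPerm_apply_of_forall_ne hl]

/-- A word not containing `b - 1` preserves the set of positions below `b`. -/
theorem wordPerm_inv_apply_lt {b : ℕ} {l : List ℕ} (hl : ∀ a ∈ l, a + 1 ≠ b) {h : ℕ}
    (hh : h < b) : (wordPerm l)⁻¹ h < b := by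
  induction l generalizing h with
  | nil => simpa [wordPerm_nil] using hh
  | cons a l ih =>
    rw [wordPerm_cons, mul_inv_rev, Equiv.Perm.mul_apply, Equiv.swap_inv]
    apply ih fun c hc => hl c (by simp [hc])
    have := hl a (by simp)
    rw [Equiv.swap_apply_def]
    split_ifs <;> omega

/-- The inversions of `w` among the positions `1, …, n`. -/
def inversions (n : ℕ) (w : Equiv.Perm ℕ) : Finset (ℕ × ℕ) :=
  (Finset.Icc 1 n ×ˢ Finset.Icc 1 n).filter fun p => p.1 < p.2 ∧ w p.2 < w p.1

theorem mem_inversions {n : ℕ} {w : Equiv.Perm ℕ} {p : ℕ × ℕ} :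
    p ∈ inversions n w ↔
      ((1 ≤ p.1 ∧ p.1 ≤ n) ∧ 1 ≤ p.2 ∧ p.2 ≤ n) ∧ p.1 < p.2 ∧ w p.2 < w p.1 := by
  simp [inversions]

theorem card_inversions_one (n : ℕ) : (inversions n 1).card = 0 := by
  rw [Finset.card_eq_zero, Finset.eq_empty_iff_forall_notMem]
  intro p hp
  have := mem_inversions.1 hp
  simp only [Equiv.Perm.one_apply] at this
  omega

theorem swap_succ_lt_swap_succ {a i k : ℕ} (hik : i < k) (h : ¬ (i = a ∧ k = a + 1)) :
    Equiv.swap a (a + 1) i < Equiv.swap a (a + 1) k := by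
  simp only [Equiv.swap_apply_def]
  split_ifs <;> omega

theorem card_inversions_mul_swap_erase_le {n a : ℕ} (w : Equiv.Perm ℕ) (ha : 1 ≤ a)
    (han : a + 1 ≤ n) :
    ((inversions n (w * Equiv.swap a (a + 1))).erase (a, a + 1)).card ≤
      ((inversions n w).erase (a, a + 1)).card := by
  apply Finset.card_le_card_of_injOn
    (fun p => (Equiv.swap a (a + 1) p.1, Equiv.swap a (a + 1) p.2))
  · rintro ⟨i, k⟩ hp
    simp only [Finset.coe_erase, Set.mem_sdiff, Finset.mem_coe, mem_inversions,
      Set.mem_singleton_iff, Prod.mk.injEq, Equiv.Perm.mul_apply] at hp ⊢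
    obtain ⟨⟨⟨hi, hk⟩, hik, hw⟩, hne⟩ := hp
    have hlt := swap_succ_lt_swap_succ hik hne
    refine ⟨⟨⟨?_, ?_⟩, hlt, hw⟩, ?_⟩
    · rw [Equiv.swap_apply_def]
      split_ifs <;> omega
    · rw [Equiv.swap_apply_def]
      split_ifs <;> omega
    · rw [Equiv.swap_apply_def, Equiv.swap_apply_def]
      split_ifs <;> omega
  · rintro ⟨i, k⟩ - ⟨i', k'⟩ - h
    simpa using h

theorem card_inversions_mul_swap_le {n a : ℕ} (w : Equiv.Perm ℕ) (ha : 1 ≤ a)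
    (han : a + 1 ≤ n) :
    (inversions n (w * Equiv.swap a (a + 1))).card ≤ (inversions n w).card + 1 := by
  have h := card_inversions_mul_swap_erase_le w ha han
  have h1 := Finset.pred_card_le_card_erase (s := inversions n (w * Equiv.swap a (a + 1)))
    (a := (a, a + 1))
  have h2 := Finset.card_erase_le (s := inversions n w) (a := (a, a + 1))
  omega

theorem card_inversions_mul_swap_lt {n a : ℕ} (w : Equiv.Perm ℕ) (ha : 1 ≤ a)
    (han : a + 1 ≤ n) (hw : w (a + 1) < w a) :
    (inversions n (w * Equiv.swap a (a + 1))).card < (inversions n w).card := by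
  have h := card_inversions_mul_swap_erase_le w ha han
  have hmem : (a, a + 1) ∈ inversions n w := by
    rw [mem_inversions]
    exact ⟨⟨⟨ha, by omega⟩, by simp, han⟩, by simp, hw⟩
  rw [Finset.erase_eq_of_notMem] at h
  · exact h.trans_lt (Finset.card_erase_lt_of_mem hmem)
  · simp only [mem_inversions, Equiv.Perm.mul_apply, Equiv.swap_apply_left,
      Equiv.swap_apply_right]
    omega

theorem card_inversions_mul_wordPerm_le {n : ℕ} (w : Equiv.Perm ℕ) {l : List ℕ}
    (hl : ∀ a ∈ l, 1 ≤ a ∧ a + 1 ≤ n) :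
    (inversions n (w * wordPerm l)).card ≤ (inversions n w).card + l.length := by
  induction l generalizing w with
  | nil => simp [wordPerm_nil]
  | cons a l ih =>
    have h1 := ih (w * Equiv.swap a (a + 1)) fun b hb => hl b (by simp [hb])
    have ha := hl a (by simp)
    have h2 := card_inversions_mul_swap_le w ha.1 ha.2
    rw [wordPerm_cons, ← mul_assoc, List.length_cons]
    omega

/-- Every letter of a reduced word is an ascent of the preceding prefix. -/
theorem wordPerm_lt_of_reduced {n : ℕ} {l l₁ l₂ : List ℕ} {a : ℕ}
    (hl : ∀ a ∈ l, 1 ≤ a ∧ a + 1 ≤ n) (hred : l.length ≤ (inversions n (wordPerm l)).card)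
    (hdec : l = l₁ ++ a :: l₂) : wordPerm l₁ a < wordPerm l₁ (a + 1) := by
  by_contra hcon
  have hlt : wordPerm l₁ (a + 1) < wordPerm l₁ a := by
    refine lt_of_le_of_ne (not_lt.1 hcon) fun h => ?_
    have := (wordPerm l₁).injective h
    omega
  subst hdec
  have ha := hl a (by simp)
  have h1 := card_inversions_mul_wordPerm_le (n := n) 1 (l := l₁)
    fun b hb => hl b (by simp [hb])
  have h2 := card_inversions_mul_swap_lt _ ha.1 ha.2 hlt
  have h3 := card_inversions_mul_wordPerm_le (wordPerm l₁ * Equiv.swap a (a + 1)) (l := l₂)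
    fun b hb => hl b (by simp [hb])
  rw [one_mul, card_inversions_one] at h1
  rw [wordPerm_append, wordPerm_cons, ← mul_assoc] at hred
  simp only [List.length_append, List.length_cons] at hred
  omega

/-- Inversions created along a reduced word persist. -/
theorem inv_wordPerm_lt_of_reduced {n : ℕ} {l l₁ l₂ : List ℕ} {h k : ℕ}
    (hl : ∀ a ∈ l, 1 ≤ a ∧ a + 1 ≤ n) (hred : l.length ≤ (inversions n (wordPerm l)).card)
    (hdec : l = l₁ ++ l₂) (hhk : h < k) (hw : wordPerm l₁ k < wordPerm l₁ h) :
    (wordPerm l)⁻¹ (wordPerm l₁ h) < (wordPerm l)⁻¹ (wordPerm l₁ k) := by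
  induction l₂ generalizing l₁ h k with
  | nil =>
    subst hdec
    simpa using hhk
  | cons a l₂ ih =>
    have hasc := wordPerm_lt_of_reduced hl hred hdec
    have hne : ¬ (h = a ∧ k = a + 1) := by
      rintro ⟨rfl, rfl⟩
      omega
    have key : ∀ x, wordPerm (l₁ ++ [a]) (Equiv.swap a (a + 1) x) = wordPerm l₁ x := by
      intro x
      simp [wordPerm_append, wordPerm_cons, wordPerm_nil]
    have := ih (l₁ := l₁ ++ [a]) (by simpa using hdec) (swap_succ_lt_swap_succ hhk hne)
      (by rwa [key, key])
    rwa [key, key] at this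

/-- Along a strictly increasing word, at most one strand passes above a given strand. -/
theorem card_filter_lt_le_of_pairwise_lt {R : List ℕ} (hR : R.Pairwise (· < ·)) (T : Finset ℕ)
    (g : Equiv.Perm ℕ) (c : ℕ) :
    (T.filter fun x => g x < c).card ≤
      (T.filter fun x => (wordPerm R)⁻¹ (g x) < (wordPerm R)⁻¹ c).card + 1 := by
  induction R generalizing g c with
  | nil => simp [wordPerm_nil]
  | cons a R ih =>
    rw [List.pairwise_cons] at hR
    simp only [wordPerm_cons, mul_inv_rev, Equiv.Perm.mul_apply, Equiv.swap_inv]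
    by_cases hc : c = a + 1
    · subst hc
      have hfix : ∀ h ≤ a, (wordPerm R)⁻¹ h = h := fun h hh =>
        wordPerm_inv_apply_of_forall_ne fun b hb => by
          have := hR.1 b hb
          omega
      refine le_trans (Finset.card_le_card (t := insert (g⁻¹ a) _) ?_)
        (Finset.card_insert_le _ _)
      intro x hx
      simp only [Finset.mem_filter, Finset.mem_insert] at hx ⊢
      by_cases hxa : g x = a
      · left
        rw [← hxa]
        simp
      · right
        refine ⟨hx.1, ?_⟩
        rw [Equiv.swap_apply_right, Equiv.swap_apply_of_ne_of_ne hxa (by omega),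
          hfix _ (by omega), hfix _ le_rfl]
        omega
    · refine le_trans (Finset.card_le_card ?_)
        (ih hR.2 (Equiv.swap a (a + 1) * g) (Equiv.swap a (a + 1) c))
      intro x hx
      rw [Finset.mem_filter] at hx ⊢
      exact ⟨hx.1, swap_succ_lt_swap_succ hx.2 (by tauto)⟩

/-- Along `r` strictly increasing words, at most `r` strands pass above a given strand. -/
theorem card_filter_lt_le_of_flatMap {f : ℕ → List ℕ} (hf : ∀ r, (f r).Pairwise (· < ·))
    (r : ℕ) (T : Finset ℕ) (g : Equiv.Perm ℕ) (c : ℕ) :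
    (T.filter fun x => g x < c).card ≤
      (T.filter fun x => (wordPerm ((List.range r).reverse.flatMap f))⁻¹ (g x) <
        (wordPerm ((List.range r).reverse.flatMap f))⁻¹ c).card + r := by
  induction r generalizing g c with
  | zero => simp [wordPerm_nil]
  | succ r ih =>
    have h1 := card_filter_lt_le_of_pairwise_lt (hf r) T g c
    have h2 := ih ((wordPerm (f r))⁻¹ * g) ((wordPerm (f r))⁻¹ c)
    simp only [List.range_succ, List.reverse_append, List.reverse_cons, List.reverse_nil,
      List.nil_append, List.singleton_append, List.flatMap_cons, wordPerm_append, mul_inv_rev,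
      Equiv.Perm.mul_apply] at h2 ⊢
    exact h1.trans ((Nat.add_le_add_right h2 1).trans_eq (add_assoc _ _ _))

/-- A letter of a word read by decreasing rows lies in some row. -/
theorem exists_row_of_flatMap_eq {f : ℕ → List ℕ} {N b : ℕ} {X Y : List ℕ}
    (h : (List.range N).reverse.flatMap f = X ++ b :: Y) :
    ∃ r U u v, r < N ∧ f r = u ++ b :: v ∧ X = U ++ u ∧ (∀ z ∈ U, ∃ r', r < r' ∧ z ∈ f r') ∧
      Y = v ++ (List.range r).reverse.flatMap f := by
  induction N generalizing X with
  | zero => simp at h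
  | succ N ih =>
    simp only [List.range_succ, List.reverse_append, List.reverse_cons, List.reverse_nil,
      List.nil_append, List.singleton_append, List.flatMap_cons] at h
    have hrow : ∀ X', (List.range N).reverse.flatMap f = X' ++ b :: Y → X = f N ++ X' →
        ∃ r U u v, r < N + 1 ∧ f r = u ++ b :: v ∧ X = U ++ u ∧ (∀ z ∈ U, ∃ r', r < r' ∧ z ∈ f r') ∧
          Y = v ++ (List.range r).reverse.flatMap f := by
      intro X' hX' hX
      obtain ⟨r, U, u, v, hr, h1, h2, h3, h4⟩ := ih hX'
      refine ⟨r, f N ++ U, u, v, hr.trans (Nat.lt_succ_self N), h1, by simp [hX, h2], ?_, h4⟩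
      intro z hz
      rcases List.mem_append.1 hz with hz | hz
      · exact ⟨N, hr, hz⟩
      · exact h3 z hz
    rcases List.append_eq_append_iff.1 h with ⟨X', hX, hrest⟩ | ⟨v, hv, hrest⟩
    · exact hrow X' hrest hX
    · cases v with
      | nil => exact hrow [] (by simpa using hrest.symm) (by simpa using hv.symm)
      | cons d v =>
        simp only [List.cons_append, List.cons.injEq] at hrest
        obtain ⟨rfl, hY⟩ := hrest
        exact ⟨N, [], X, v, Nat.lt_succ_self N, hv, by simp, by simp, hY⟩

/-- If `b` occurs at least twice more than `c`, some two occurrences of `b` are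
separated by neither `b` nor `c`. -/
theorem exists_consecutive_of_count {b c : ℕ} (hbc : b ≠ c) {l : List ℕ}
    (h : 1 + l.count c < l.count b) :
    ∃ l₁ m l₂, l = l₁ ++ b :: (m ++ b :: l₂) ∧ b ∉ m ∧ c ∉ m := by
  have main : ∀ l : List ℕ, (∃ l₁ m l₂, l = l₁ ++ b :: (m ++ b :: l₂) ∧ b ∉ m ∧ c ∉ m) ∨
      (l.count b ≤ l.count c + 1 ∧
        (l.count b ≤ l.count c ∨ ∃ m l₂, l = m ++ b :: l₂ ∧ b ∉ m ∧ c ∉ m)) := by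
    intro l
    induction l with
    | nil => simp
    | cons x l ih =>
      rcases ih with ⟨l₁, m, l₂, rfl, hm⟩ | ⟨h1, h2⟩
      · exact Or.inl ⟨x :: l₁, m, l₂, rfl, hm⟩
      by_cases hxb : x = b
      · subst hxb
        rcases h2 with h2 | ⟨m, l₂, rfl, hm⟩
        · right
          rw [List.count_cons_self, List.count_cons_of_ne hbc]
          exact ⟨by omega, Or.inr ⟨[], l, rfl, by simp, by simp⟩⟩
        · exact Or.inl ⟨[], m, l₂, rfl, hm⟩
      · right
        rw [List.count_cons_of_ne hxb]
        by_cases hxc : x = c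
        · subst hxc
          rw [List.count_cons_self]
          exact ⟨by omega, Or.inl h1⟩
        · rw [List.count_cons_of_ne hxc]
          refine ⟨h1, h2.imp_right ?_⟩
          rintro ⟨m, l₂, rfl, hb, hc⟩
          exact ⟨x :: m, l₂, rfl, by simp [hb, Ne.symm hxb], by simp [hc, Ne.symm hxc]⟩
  rcases main l with h' | h'
  · exact h'
  · omega

/-- The letters of row `r + 1` of a pipe dream, from left to right. -/
def rowWord (n : ℕ) (C : Finset (ℕ × ℕ)) (r : ℕ) : List ℕ :=
  (List.range n).filterMap fun c => if (r + 1, c + 1) ∈ C then some (r + c + 1) else none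

theorem mem_rowWord {n : ℕ} {C : Finset (ℕ × ℕ)} {r a : ℕ} (h : a ∈ rowWord n C r) :
    ∃ c, (r + 1, c + 1) ∈ C ∧ a = r + c + 1 := by
  simp only [rowWord, List.mem_filterMap, Option.ite_none_right_eq_some,
    Option.some.injEq] at h
  obtain ⟨c, -, h1, h2⟩ := h
  exact ⟨c, h1, h2.symm⟩

theorem pairwise_rowWord (n : ℕ) (C : Finset (ℕ × ℕ)) (r : ℕ) :
    (rowWord n C r).Pairwise (· < ·) := by
  rw [rowWord, List.pairwise_filterMap]
  refine List.pairwise_lt_range.imp fun {c d} hcd x hx y hy => ?_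
  simp only [Option.ite_none_right_eq_some, Option.some.injEq] at hx hy
  omega

theorem readingWord_eq_flatMap_rowWord (n : ℕ) (C : Finset (ℕ × ℕ)) :
    readingWord n C = (List.range (n - 1)).reverse.flatMap (rowWord n C) := rfl

/-- A reduced word made of rows with two consecutive occurrences of `j + 1` not separated by `j`
produces a 1432 pattern. -/
theorem exists_pattern_of_consecutive {n j : ℕ} {C : Finset (ℕ × ℕ)} {l₁ m l₂ : List ℕ}
    (hl : ∀ a ∈ readingWord n C, 1 ≤ a ∧ a + 1 ≤ n)
    (hred : (readingWord n C).length ≤ (inversions n (wordPerm (readingWord n C))).card)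
    (hdec : readingWord n C = l₁ ++ (j + 1) :: (m ++ (j + 1) :: l₂))
    (hb : j + 1 ∉ m) (hj : j ∉ m) :
    ∃ x A B D, 1 ≤ x ∧ x < A ∧ A < B ∧ B < D ∧
      (wordPerm (readingWord n C))⁻¹ x < (wordPerm (readingWord n C))⁻¹ D ∧
      (wordPerm (readingWord n C))⁻¹ D < (wordPerm (readingWord n C))⁻¹ B ∧
      (wordPerm (readingWord n C))⁻¹ B < (wordPerm (readingWord n C))⁻¹ A := by
  set L := readingWord n C with hL
  have hdec' : L = (l₁ ++ (j + 1) :: m) ++ (j + 1) :: l₂ := by simpa using hdec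
  obtain ⟨r, U, u, v, -, hrow, hU, hUrow, hV⟩ :=
    exists_row_of_flatMap_eq ((readingWord_eq_flatMap_rowWord n C).symm.trans hdec')
  have hsort := pairwise_rowWord n C r
  rw [hrow, List.pairwise_append, List.pairwise_cons] at hsort
  obtain ⟨-, ⟨hv, -⟩, hu⟩ := hsort
  have hUge : ∀ z ∈ U, r + 2 ≤ z := by
    intro z hz
    obtain ⟨r', hr', hz'⟩ := hUrow z hz
    obtain ⟨c, -, rfl⟩ := mem_rowWord hz'
    omega
  -- the second occurrence lies in a strictly higher row than the first
  obtain ⟨hl₁, hjr⟩ : (∀ z ∈ l₁, r + 2 ≤ z) ∧ r + 2 ≤ j + 1 := by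
    have hnu : j + 1 ∉ u := fun h => lt_irrefl _ (hu _ h _ (by simp))
    rcases List.append_eq_append_iff.1 hU with ⟨e, hUe, hrest⟩ | ⟨e, hle, hrest⟩
    · cases e with
      | nil =>
        simp only [List.nil_append] at hrest
        exact absurd (by simp [← hrest]) hnu
      | cons d e =>
        simp only [List.cons_append, List.cons.injEq] at hrest
        obtain ⟨rfl, -⟩ := hrest
        subst hUe
        exact ⟨fun z hz => hUge z (by simp [hz]), hUge _ (by simp)⟩
    · exact absurd (by simp [hrest]) hnu
  have hw₁ : ∀ y < r + 2, wordPerm l₁ y = y := fun y hy =>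
    wordPerm_apply_of_forall_ne fun a ha => by
      have := hl₁ a ha
      omega
  have hasc₁ := wordPerm_lt_of_reduced hl hred hdec
  have hasc₂ := wordPerm_lt_of_reduced hl hred hdec'
  have hB : wordPerm (l₁ ++ (j + 1) :: m) (j + 1) = wordPerm l₁ (j + 1 + 1) := by
    rw [wordPerm_append, wordPerm_cons, Equiv.Perm.mul_apply, Equiv.Perm.mul_apply,
      wordPerm_apply_of_forall_ne (h := j + 1), Equiv.swap_apply_left]
    intro a ha
    exact ⟨fun h => hb (h ▸ ha), fun h => hj (by rwa [Nat.succ.inj h] at ha)⟩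
  have hBA := inv_wordPerm_lt_of_reduced hl hred (l₁ := l₁ ++ [j + 1])
    (l₂ := m ++ (j + 1) :: l₂) (by simp [hdec]) (Nat.lt_succ_self (j + 1))
    (by simpa [wordPerm_append, wordPerm_cons, wordPerm_nil] using hasc₁)
  have hDB := inv_wordPerm_lt_of_reduced hl hred (l₁ := l₁ ++ (j + 1) :: m ++ [j + 1])
    (l₂ := l₂) (by simp [hdec]) (Nat.lt_succ_self (j + 1))
    (by
      rw [wordPerm_append _ [j + 1]]
      simpa [wordPerm_cons, wordPerm_nil] using hasc₂)
  rw [wordPerm_append _ [j + 1]] at hBA hDB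
  simp only [wordPerm_cons, wordPerm_nil, mul_one, Equiv.Perm.mul_apply,
    Nat.succ_eq_add_one, Equiv.swap_apply_left, Equiv.swap_apply_right] at hBA hDB
  rw [← hB] at hBA
  set D := wordPerm (l₁ ++ (j + 1) :: m) (j + 1 + 1) with hD
  -- after the second occurrence, the labels `1, …, r + 1` all lie below `D`
  set g := (wordPerm (l₁ ++ (j + 1) :: m ++ (j + 1) :: v))⁻¹ with hg
  have hvfix : ∀ h ≤ j + 1, (wordPerm v)⁻¹ h = h := fun h hh =>
    wordPerm_inv_apply_of_forall_ne fun a ha => by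
      have := hv a ha
      omega
  have hgD : g D = j + 1 := by
    rw [hg, wordPerm_append, wordPerm_cons, mul_inv_rev, mul_inv_rev, Equiv.Perm.mul_apply,
      Equiv.Perm.mul_apply, Equiv.Perm.inv_eq_iff_eq.2 hD, Equiv.swap_inv,
      Equiv.swap_apply_right, hvfix _ le_rfl]
  have hgx : ∀ x < r + 2, g x < g D := by
    intro x hx
    have h1 : (wordPerm l₁)⁻¹ x = x := by rw [Equiv.Perm.inv_eq_iff_eq, hw₁ x hx]
    have h2 : (wordPerm (l₁ ++ (j + 1) :: m))⁻¹ x < j + 1 := by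
      rw [wordPerm_append, mul_inv_rev, Equiv.Perm.mul_apply, h1]
      refine wordPerm_inv_apply_lt ?_ (by omega)
      intro a ha h
      rcases List.mem_cons.1 ha with rfl | ha
      · omega
      · exact hj (by rwa [Nat.succ.inj h] at ha)
    rw [hgD, hg, wordPerm_append, wordPerm_cons, mul_inv_rev, mul_inv_rev,
      Equiv.Perm.mul_apply, Equiv.Perm.mul_apply, Equiv.swap_inv,
      Equiv.swap_apply_of_ne_of_ne h2.ne (by omega), hvfix _ h2.le]
    exact h2
  have hLg : (wordPerm L)⁻¹ =
      (wordPerm ((List.range r).reverse.flatMap (rowWord n C)))⁻¹ * g := by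
    rw [hdec', hV, ← List.cons_append, ← List.append_assoc, wordPerm_append _
      ((List.range r).reverse.flatMap (rowWord n C)), mul_inv_rev]
  have hcount := card_filter_lt_le_of_flatMap (pairwise_rowWord n C) r
    (Finset.Icc 1 (r + 1)) g (g D)
  rw [Finset.filter_true_of_mem fun x hx => hgx x (by rw [Finset.mem_Icc] at hx; omega),
    Nat.card_Icc] at hcount
  obtain ⟨x, hx⟩ := Finset.card_pos.1 (Nat.pos_of_lt_add_left (lt_of_lt_of_le
    (by omega : r < r + 1 + 1 - 1) hcount))
  rw [Finset.mem_filter, Finset.mem_Icc] at hx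
  refine ⟨x, wordPerm l₁ (j + 1), wordPerm (l₁ ++ (j + 1) :: m) (j + 1), D, hx.1.1, ?_, ?_,
    hasc₂, ?_, hDB, hBA⟩
  · by_contra hcon
    have := (wordPerm l₁).injective (hw₁ (wordPerm l₁ (j + 1)) (by omega))
    omega
  · rwa [hB]
  · rw [hLg]
    exact hx.2

/-- If `π` is a permutation of `{1,…,n}` avoiding the pattern 1432, then every
reduced pipe dream for `π` is pseudo-Yamanouchi. -/
theorem pseudoYamanouchi_of_reduced_of_avoids1432 (n : ℕ) (π : Equiv.Perm ℕ)
    (hπ : ∀ m : ℕ, m = 0 ∨ n < m → π m = m)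
    (hav : Avoids1432 n π)
    (C : Finset (ℕ × ℕ)) (hC : IsReducedPipeDream n π C) :
    PseudoYamanouchi n C := by
  obtain ⟨hP, hprod, hlen⟩ := hC
  intro k j _ _
  by_contra hcon
  obtain ⟨l₁, m, l₂, hdec, hb, hj⟩ :=
    exists_consecutive_of_count (Nat.succ_ne_self j) (not_le.1 hcon)
  have hdec' : readingWord n C =
      l₁ ++ (j + 1) :: (m ++ (j + 1) :: (l₂ ++ (readingWord n C).drop k)) := by
    conv_lhs => rw [← List.take_append_drop k (readingWord n C), hdec]
    simp
  have hl : ∀ a ∈ readingWord n C, 1 ≤ a ∧ a + 1 ≤ n := by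
    intro a ha
    rw [readingWord_eq_flatMap_rowWord, List.mem_flatMap] at ha
    obtain ⟨r, -, ha⟩ := ha
    obtain ⟨c, hc, rfl⟩ := mem_rowWord ha
    have := hP _ hc
    simp only at this
    omega
  change wordPerm (readingWord n C) = π at hprod
  have hred : (readingWord n C).length ≤
      (inversions n (wordPerm (readingWord n C))).card := by
    rw [hprod]
    exact hlen.le
  obtain ⟨x, A, B, D, hx, hxA, hAB, hBD, hxD, hDB, hBA⟩ :=
    exists_pattern_of_consecutive hl hred hdec' hb hj
  rw [hprod] at hxD hDB hBA
  refine hav ⟨π⁻¹ x, π⁻¹ D, π⁻¹ B, π⁻¹ A, ?_, hxD, hDB, hBA, ?_, ?_⟩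
  · by_contra h0
    have h0' : π⁻¹ x = 0 := by omega
    rw [Equiv.Perm.inv_eq_iff_eq, hπ 0 (Or.inl rfl)] at h0'
    omega
  · by_contra hn
    have hA := hπ _ (Or.inr (not_le.1 hn))
    rw [← Equiv.Perm.mul_apply, mul_inv_cancel, Equiv.Perm.one_apply] at hA
    have hB : π⁻¹ B = B := by
      rw [Equiv.Perm.inv_eq_iff_eq, hπ B (Or.inr (by omega))]
    omega
  · simp only [← Equiv.Perm.mul_apply, mul_inv_cancel, Equiv.Perm.one_apply]
    exact ⟨hxA, hAB, hBD⟩
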